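/- Let n ≥ 3, q > 1, C_0 > 0, and s > 1. If u is a nonnegative locally Lipschitz function on an open set Ω ⊆ ℝ^n satisfying Δu + C_0 u^q ≥ 0 weakly in Ω, then for every nonnegative Lipschitz function φ with compact support in Ω, ∫ φ² u^{q+s-1} dx ≥ C_0^{-1} ∫ ( (2(s-1)/s²) |φ ∇(u^{s/2})|² − (2/(s-1)) |∇φ|² u^s ) dx. -/

import Mathlib

open MeasureTheory Metric Finset Filter Asymptotics
open scoped RealInnerProductSpace

noncomputable section

/-- `pder u i x` is the partial derivative `Dᵢ u (x)` in the `i`-th coordinate direction. -/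
def pder {n : ℕ} (u : EuclideanSpace ℝ (Fin n) → ℝ) (i : Fin n)
    (x : EuclideanSpace ℝ (Fin n)) : ℝ :=
  fderiv ℝ u x (EuclideanSpace.single i 1)

/-- The Euclidean Laplacian `Δu = ∑ i, D_i D_i u`. -/
def lap {n : ℕ} (u : EuclideanSpace ℝ (Fin n) → ℝ)
    (x : EuclideanSpace ℝ (Fin n)) : ℝ :=
  ∑ i : Fin n, pder (pder u i) i x

/-- `|∇V|² = ∑_{l,j} (D_l V_j)²` for a vector-valued map `V`. -/
def gradNormSq {n m : ℕ}
    (V : EuclideanSpace ℝ (Fin n) → EuclideanSpace ℝ (Fin m))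
    (x : EuclideanSpace ℝ (Fin n)) : ℝ :=
  ∑ l : Fin n, ∑ j : Fin m, (pder (fun y => V y j) l x) ^ 2

/-- `Δu + F ≥ 0` weakly on `Ω`: for every nonnegative smooth compactly supported
test function `φ` in `Ω`, `∫_Ω (-⟨∇u, ∇φ⟩ + F φ) ≥ 0`. -/
def IsWeakSupersol {n : ℕ} (Ω : Set (EuclideanSpace ℝ (Fin n)))
    (u F : EuclideanSpace ℝ (Fin n) → ℝ) : Prop :=
  ∀ φ : EuclideanSpace ℝ (Fin n) → ℝ, ContDiff ℝ (⊤ : ℕ∞) φ → HasCompactSupport φ →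
    tsupport φ ⊆ interior Ω → (∀ x, 0 ≤ φ x) →
    0 ≤ ∫ x in Ω, (-⟪gradient u x, gradient φ x⟫ + F x * φ x)

/-- `Cs` is a constant for the Sobolev inequality
`(∫ |w|^{2n/(n-2)})^{(n-2)/n} ≤ Cs ∫ |∇w|²` for compactly supported Lipschitz `w` on `ℝⁿ`. -/
def SobolevIneq (n : ℕ) (Cs : ℝ) : Prop :=
  ∀ w : EuclideanSpace ℝ (Fin n) → ℝ, (∃ K, LipschitzWith K w) → HasCompactSupport w →
    (∫ x, |w x| ^ ((2 * (n : ℝ)) / ((n : ℝ) - 2))) ^ (((n : ℝ) - 2) / (n : ℝ))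
      ≤ Cs * ∫ x, ‖gradient w x‖ ^ 2

open scoped Topology Convolution NNReal
open ContinuousLinearMap (lsmul)

section Mollification

variable {E : Type*} [NormedAddCommGroup E] [NormedSpace ℝ E] [FiniteDimensional ℝ E]
  [MeasurableSpace E] [BorelSpace E] {μ : Measure E} [μ.IsAddHaarMeasure]

/-- The derivative of the mollification of a Lipschitz function is the mollification of its
almost everywhere derivative. -/
theorem LipschitzWith.hasFDerivAt_normed_convolution [HasContDiffBump E] {f : E → ℝ} {K : ℝ≥0}
    (hf : LipschitzWith K f) (ρ : ContDiffBump (0 : E)) (x : E) :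
    HasFDerivAt (ρ.normed μ ⋆[lsmul ℝ ℝ, μ] f)
      ((ρ.normed μ ⋆[lsmul ℝ ℝ, μ] fderiv ℝ f) x) x := by
  have hmeas : ∀ y : E, Measurable fun t : E => y - t := fun y => by fun_prop
  refine (hasFDerivAt_integral_of_dominated_loc_of_lip (F := fun x t => ρ.normed μ t • f (x - t))
    (F' := fun t => ρ.normed μ t • fderiv ℝ f (x - t)) (bound := fun t => K * ρ.normed μ t)
    univ_mem ?_ ?_ ?_ ?_ ?_ ?_).2
  · refine Eventually.of_forall fun y => Continuous.aestronglyMeasurable ?_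
    have := ρ.continuous_normed (μ := μ)
    have := hf.continuous
    fun_prop
  · refine Continuous.integrable_of_hasCompactSupport ?_ ?_
    · have := ρ.continuous_normed (μ := μ)
      have := hf.continuous
      fun_prop
    · exact ρ.hasCompactSupport_normed.smul_right
  · refine Measurable.aestronglyMeasurable ?_
    exact (ρ.continuous_normed (μ := μ)).measurable.smul ((measurable_fderiv ℝ f).comp (hmeas x))
  · refine Eventually.of_forall fun t => LipschitzOnWith.of_dist_le_mul fun y _ z _ => ?_
    have h0 := ρ.nonneg_normed (μ := μ) t
    have h1 := hf.dist_le_mul (y - t) (z - t)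
    simp only [dist_sub_right] at h1
    have h2 : 0 ≤ K * ρ.normed μ t := by positivity
    simp only [Real.coe_nnabs, abs_of_nonneg h2, smul_eq_mul, Real.dist_eq, ← mul_sub, abs_mul,
      abs_of_nonneg h0] at h1 ⊢
    nlinarith
  · exact ρ.integrable_normed.const_mul _
  · have h := (quasiMeasurePreserving_sub_left μ x).ae hf.ae_differentiableAt
    filter_upwards [h] with t ht
    exact ((hasFDerivAt_comp_sub t).2 ht.hasFDerivAt).const_smul (ρ.normed μ t)

theorem ContDiffBump.norm_normed_convolution_le [HasContDiffBump E]
    {F : Type*} [NormedAddCommGroup F] [NormedSpace ℝ F]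
    (ρ : ContDiffBump (0 : E)) {g : E → F} {C : ℝ} (hg : ∀ x, ‖g x‖ ≤ C) (x : E) :
    ‖(ρ.normed μ ⋆[lsmul ℝ ℝ, μ] g) x‖ ≤ C := by
  calc ‖(ρ.normed μ ⋆[lsmul ℝ ℝ, μ] g) x‖ ≤ ∫ t, ρ.normed μ t * C ∂μ := by
        refine norm_integral_le_of_norm_le (ρ.integrable_normed.mul_const C) ?_
        refine Eventually.of_forall fun t => ?_
        rw [ContinuousLinearMap.lsmul_apply, norm_smul, Real.norm_of_nonneg (ρ.nonneg_normed t)]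
        exact mul_le_mul_of_nonneg_left (hg _) (ρ.nonneg_normed t)
    _ = C := by rw [integral_mul_const, ρ.integral_normed, one_mul]

theorem ContDiffBump.tsupport_normed_convolution_subset [HasContDiffBump E]
    (ρ : ContDiffBump (0 : E)) (f : E → ℝ) :
    tsupport (ρ.normed μ ⋆[lsmul ℝ ℝ, μ] f) ⊆ cthickening ρ.rOut (tsupport f) := by
  refine closure_minimal ?_ isClosed_cthickening
  refine (support_convolution_subset_swap _).trans ?_
  rw [ρ.support_normed_eq]
  rintro _ ⟨a, ha, b, hb, rfl⟩
  refine mem_cthickening_of_dist_le _ a _ _ (subset_tsupport f ha) ?_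
  simpa [dist_eq_norm] using (mem_ball_zero_iff.1 hb).le

/-- A linear first-order inequality with bounded coefficients that holds for all nonnegative smooth
test functions supported in an open set also holds for nonnegative Lipschitz ones. -/
theorem LipschitzWith.integral_fderiv_add_nonneg_of_smooth [HasContDiffBump E] {U : Set E}
    (hU : IsOpen U)
    {G : E → E} {F : E → ℝ} {A B : ℝ} (hGm : Measurable G) (hFm : Measurable F)
    (hG : ∀ x, ‖G x‖ ≤ A) (hF : ∀ x, |F x| ≤ B)
    (h : ∀ ψ : E → ℝ, ContDiff ℝ (⊤ : ℕ∞) ψ → HasCompactSupport ψ → tsupport ψ ⊆ U →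
      (∀ x, 0 ≤ ψ x) → 0 ≤ ∫ x, (fderiv ℝ ψ x (G x) + F x * ψ x) ∂μ)
    {ψ : E → ℝ} {K : ℝ≥0} (hψ : LipschitzWith K ψ) (hψc : HasCompactSupport ψ)
    (hψU : tsupport ψ ⊆ U) (hψ0 : ∀ x, 0 ≤ ψ x) :
    0 ≤ ∫ x, (fderiv ℝ ψ x (G x) + F x * ψ x) ∂μ := by
  obtain ⟨δ, hδ, hδU⟩ := IsCompact.exists_cthickening_subset_open hψc hU hψU
  obtain ⟨M, hM⟩ := hψ.continuous.bounded_above_of_compact_support hψc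
  let ρ : ℕ → ContDiffBump (0 : E) := fun k =>
    { rIn := δ / (k + 2) / 2
      rOut := δ / (k + 2)
      rIn_pos := by positivity
      rIn_lt_rOut := half_lt_self (by positivity) }
  have hρδ : ∀ k, (ρ k).rOut ≤ δ := fun k =>
    div_le_self hδ.le (by have : (0 : ℝ) ≤ k := k.cast_nonneg
                          linarith)
  have hρ : Tendsto (fun k => (ρ k).rOut) atTop (𝓝 0) := by
    refine Tendsto.const_div_atTop ?_ δ
    exact tendsto_atTop_add_const_right _ _ tendsto_natCast_atTop_atTop
  have hρK : ∀ᶠ k in atTop, (ρ k).rOut ≤ 2 * (ρ k).rIn :=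
    Eventually.of_forall fun k => by
      change δ / (k + 2) ≤ 2 * (δ / (k + 2) / 2)
      linarith
  set η : ℕ → E → ℝ := fun k => (ρ k).normed μ ⋆[lsmul ℝ ℝ, μ] ψ with hη
  have hηd : ∀ k x, fderiv ℝ (η k) x = ((ρ k).normed μ ⋆[lsmul ℝ ℝ, μ] fderiv ℝ ψ) x :=
    fun k x => (hψ.hasFDerivAt_normed_convolution (ρ k) x).fderiv
  have hKcomp : IsCompact (cthickening δ (tsupport ψ)) := IsCompact.cthickening hψc
  have hηsub : ∀ k, tsupport (η k) ⊆ cthickening δ (tsupport ψ) := fun k =>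
    ((ρ k).tsupport_normed_convolution_subset ψ).trans (cthickening_mono (hρδ k) _)
  have hpos : ∀ k, 0 ≤ ∫ x, (fderiv ℝ (η k) x (G x) + F x * η k x) ∂μ := fun k => by
    refine h (η k) ?_ ?_ ((hηsub k).trans hδU) ?_
    · exact (ρ k).hasCompactSupport_normed.contDiff_convolution_left _ (ρ k).contDiff_normed
        hψ.continuous.locallyIntegrable
    · exact hKcomp.of_isClosed_subset (isClosed_tsupport _) (hηsub k)
    · exact fun x => integral_nonneg fun t => mul_nonneg ((ρ k).nonneg_normed t) (hψ0 _)
  refine ge_of_tendsto' (x := atTop) ?_ hpos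
  have hKbd : ∀ x, ‖fderiv ℝ ψ x‖ ≤ K := fun x => norm_fderiv_le_of_lipschitz ℝ hψ
  have hA : 0 ≤ A := (norm_nonneg _).trans (hG 0)
  have hB : 0 ≤ B := (abs_nonneg _).trans (hF 0)
  refine tendsto_integral_of_dominated_convergence
    ((cthickening δ (tsupport ψ)).indicator fun _ => K * A + B * M) ?_ ?_ ?_ ?_
  · intro k
    refine Measurable.aestronglyMeasurable ?_
    have h1 : Continuous (η k) := continuous_iff_continuousAt.2 fun x =>
      (hψ.hasFDerivAt_normed_convolution (ρ k) x).continuousAt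
    have h2 := measurable_fderiv ℝ (η k)
    have h2' : Measurable fun x => fderiv ℝ (η k) x (G x) :=
      isBoundedBilinearMap_apply.continuous.measurable.comp (h2.prodMk hGm)
    exact h2'.add (hFm.mul h1.measurable)
  · exact (integrable_indicator_iff isClosed_cthickening.measurableSet).2
      (integrableOn_const hKcomp.measure_lt_top.ne)
  · refine fun k => Eventually.of_forall fun x => ?_
    by_cases hx : x ∈ cthickening δ (tsupport ψ)
    · rw [Set.indicator_of_mem hx]
      have h1 : ‖fderiv ℝ (η k) x (G x)‖ ≤ K * A :=
        (ContinuousLinearMap.le_opNorm _ _).trans (mul_le_mul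
          (by rw [hηd]; exact (ρ k).norm_normed_convolution_le hKbd x) (hG x) (norm_nonneg _)
          K.coe_nonneg)
      have h2 : ‖F x * η k x‖ ≤ B * M := by
        rw [norm_mul]
        exact mul_le_mul (hF x) ((ρ k).norm_normed_convolution_le hM x) (norm_nonneg _) hB
      exact (norm_add_le _ _).trans (add_le_add h1 h2)
    · have h1 : x ∉ tsupport (η k) := fun hx' => hx (hηsub k hx')
      rw [Set.indicator_of_notMem hx, image_eq_zero_of_notMem_tsupport h1,
        fderiv_of_notMem_tsupport ℝ h1]
      simp
  · have hψ' : LocallyIntegrable (fderiv ℝ ψ) μ := by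
      refine (locallyIntegrable_const (K : ℝ)).mono
        (measurable_fderiv ℝ ψ).aestronglyMeasurable (Eventually.of_forall fun x => ?_)
      simpa using hKbd x
    filter_upwards [ContDiffBump.ae_convolution_tendsto_right_of_locallyIntegrable hρ hρK hψ',
      ContDiffBump.ae_convolution_tendsto_right_of_locallyIntegrable hρ hρK
        hψ.continuous.locallyIntegrable] with x hx1 hx2
    simp only [hηd]
    exact (((ContinuousLinearMap.apply ℝ ℝ (G x)).continuous.tendsto _).comp hx1).add
      (hx2.const_mul _)

end Mollification

section Caccioppoli

theorem Real.rpow_le_rpow_add_rpow {a b c : ℝ} (p : ℝ) (ha : 0 < a) (hab : a ≤ b) (hbc : b ≤ c) :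
    b ^ p ≤ a ^ p + c ^ p := by
  rcases le_total 0 p with hp | hp
  · exact (Real.rpow_le_rpow (ha.le.trans hab) hbc hp).trans
      (le_add_of_nonneg_left (Real.rpow_nonneg ha.le p))
  · exact (Real.rpow_le_rpow_of_nonpos ha hab hp).trans
      (le_add_of_nonneg_right (Real.rpow_nonneg (ha.le.trans (hab.trans hbc)) p))

theorem LipschitzWith.exists_lipschitzWith_sq_mul_add_rpow {X : Type*} [PseudoEMetricSpace X]
    {φ w : X → ℝ} {K L : ℝ≥0} {N M ε p : ℝ} (hφ : LipschitzWith K φ) (hw : LipschitzWith L w)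
    (hε : 0 < ε) (hφN : ∀ x, φ x ∈ Set.Icc 0 N) (hwM : ∀ x, w x ∈ Set.Icc 0 M) :
    ∃ C, LipschitzWith C fun x => φ x ^ 2 * (w x + ε) ^ p := by
  have hH : ContDiffOn ℝ 1 (fun z : ℝ × ℝ => z.1 ^ 2 * (z.2 + ε) ^ p)
      (Set.Icc 0 N ×ˢ Set.Icc 0 M) := by
    intro z hz
    have h1 : z.2 + ε ≠ 0 := by
      have := hz.2.1
      positivity
    have h2 : ContDiffAt ℝ 1 (fun z : ℝ × ℝ => z.2 + ε) z := by fun_prop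
    exact ((contDiffAt_fst.pow 2).mul (h2.rpow_const_of_ne h1)).contDiffWithinAt
  obtain ⟨C, hC⟩ := hH.exists_lipschitzOnWith one_ne_zero
    ((convex_Icc _ _).prod (convex_Icc _ _)) (isCompact_Icc.prod isCompact_Icc)
  have h3 := hC.comp (lipschitzOnWith_univ.2 (hφ.prodMk hw)) fun x _ => ⟨hφN x, hwM x⟩
  exact ⟨_, lipschitzOnWith_univ.1 h3⟩

variable {E : Type*} [NormedAddCommGroup E] [InnerProductSpace ℝ E]

section Gradient

variable [CompleteSpace E]

theorem norm_gradient_eq_norm_fderiv (f : E → ℝ) (x : E) : ‖gradient f x‖ = ‖fderiv ℝ f x‖ :=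
  LinearIsometryEquiv.norm_map _ _

theorem measurable_gradient [MeasurableSpace E] [BorelSpace E] (f : E → ℝ) :
    Measurable (gradient f) :=
  (InnerProductSpace.toDual ℝ E).symm.continuous.measurable.comp (measurable_fderiv ℝ f)

theorem gradient_of_notMem_tsupport {f : E → ℝ} {x : E} (hx : x ∉ tsupport f) :
    gradient f x = 0 := by
  rw [gradient, fderiv_of_notMem_tsupport ℝ hx, map_zero]

theorem LipschitzWith.norm_gradient_le {f : E → ℝ} {K : ℝ≥0} (hf : LipschitzWith K f) (x : E) :
    ‖gradient f x‖ ≤ K :=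
  (norm_gradient_eq_norm_fderiv f x).trans_le (norm_fderiv_le_of_lipschitz ℝ hf)

theorem norm_gradient_rpow_sq {w : E → ℝ} {x : E} {s : ℝ} (hw0 : ∀ y, 0 ≤ w y) (hs : 0 < s)
    (hw : DifferentiableAt ℝ w x) :
    ‖gradient (fun y => w y ^ (s / 2)) x‖ ^ 2 =
      if 0 < w x then s ^ 2 / 4 * (w x ^ (s - 2) * ‖gradient w x‖ ^ 2) else 0 := by
  rw [norm_gradient_eq_norm_fderiv, norm_gradient_eq_norm_fderiv]
  split_ifs with h
  · rw [(hw.hasFDerivAt.rpow_const (Or.inl h.ne')).fderiv, norm_smul, mul_pow, Real.norm_eq_abs,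
      sq_abs, mul_pow, ← Real.rpow_natCast (w x ^ (s / 2 - 1)) 2, ← Real.rpow_mul h.le]
    ring_nf
  · have h0 : w x = 0 := le_antisymm (not_lt.1 h) (hw0 x)
    have hmin : IsLocalMin (fun y => w y ^ (s / 2)) x := Eventually.of_forall fun y => by
      simp only [h0, Real.zero_rpow (half_pos hs).ne']
      exact Real.rpow_nonneg (hw0 y) _
    rw [hmin.fderiv_eq_zero]
    simp

theorem hasGradientAt_sq_mul_add_rpow {φ w : E → ℝ} {x : E} {ε p : ℝ}
    (hφ : DifferentiableAt ℝ φ x) (hw : DifferentiableAt ℝ w x) (h0 : 0 < w x + ε) :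
    HasGradientAt (fun y => φ y ^ 2 * (w y + ε) ^ p)
      ((2 * φ x * (w x + ε) ^ p) • gradient φ x
        + (p * φ x ^ 2 * (w x + ε) ^ (p - 1)) • gradient w x) x := by
  rw [hasGradientAt_iff_hasFDerivAt]
  have h1 := (hφ.hasFDerivAt.pow 2).mul
    ((hw.hasFDerivAt.add_const ε).rpow_const (p := p) (Or.inl h0.ne'))
  refine h1.congr_fderiv ?_
  ext v
  simp [gradient]
  ring

end Gradient

/-- Pointwise form of the energy estimate: the Young inequality applied to
`⟪∇w, ∇(φ² (w + ε)ˢ⁻¹)⟫`, with `g = ∇w`, `h = ∇φ` and `v = w + ε`. -/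
theorem neg_inner_le_of_young (g h : E) {a v s : ℝ} (hv : 0 < v) (hs : 1 < s) (ha : 0 ≤ a) :
    -⟪g, (2 * a * v ^ (s - 1)) • h + ((s - 1) * a ^ 2 * v ^ (s - 1 - 1)) • g⟫ ≤
      -((s - 1) / 2 * (a ^ 2 * (v ^ (s - 2) * ‖g‖ ^ 2))) + 2 / (s - 1) * (‖h‖ ^ 2 * v ^ s) := by
  have e1 : v ^ (s - 1) = v ^ (s - 2) * v := by
    rw [← Real.rpow_add_one hv.ne']; ring_nf
  have e2 : v ^ s = v ^ (s - 2) * v ^ 2 := by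
    rw [← Real.rpow_natCast v 2, ← Real.rpow_add hv]; norm_num
  have e3 : v ^ (s - 1 - 1) = v ^ (s - 2) := by ring_nf
  have hc : 0 < v ^ (s - 2) := Real.rpow_pos_of_pos hv _
  rw [e1, e2, e3, inner_add_right, inner_smul_right, inner_smul_right, real_inner_self_eq_norm_sq]
  generalize v ^ (s - 2) = c at hc
  have hgh : -(‖g‖ * ‖h‖) ≤ ⟪g, h⟫ := (abs_le.1 (abs_real_inner_le_norm g h)).1
  have hs' : 0 < s - 1 := sub_pos.2 hs
  have key : 0 ≤ c * (2 / (s - 1) * ((s - 1) / 2 * (a * ‖g‖) - ‖h‖ * v) ^ 2) := by positivity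
  have key2 : 0 ≤ 2 * a * (c * v) * (⟪g, h⟫ + ‖g‖ * ‖h‖) :=
    mul_nonneg (by positivity) (by linarith)
  have key3 : c * (2 / (s - 1) * ((s - 1) / 2 * (a * ‖g‖) - ‖h‖ * v) ^ 2) =
      (s - 1) / 2 * (a ^ 2 * (c * ‖g‖ ^ 2)) - 2 * a * (c * v) * (‖g‖ * ‖h‖)
        + 2 / (s - 1) * (‖h‖ ^ 2 * (c * v ^ 2)) := by
    field_simp
    ring
  linarith

variable [FiniteDimensional ℝ E] [MeasurableSpace E] [BorelSpace E] {μ : Measure E}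
  [μ.IsAddHaarMeasure]

theorem LipschitzWith.integrable_gradient {f : E → ℝ} {K : ℝ≥0} (hf : LipschitzWith K f)
    (hfc : HasCompactSupport f) : Integrable (gradient f) μ := by
  refine Integrable.mono' (g := (tsupport f).indicator fun _ => (K : ℝ)) ?_
    (measurable_gradient f).aestronglyMeasurable (Eventually.of_forall fun x => ?_)
  · exact (integrable_indicator_iff (isClosed_tsupport f).measurableSet).2
      (integrableOn_const hfc.isCompact.measure_lt_top.ne)
  · by_cases hx : x ∈ tsupport f
    · rw [Set.indicator_of_mem hx]
      exact hf.norm_gradient_le x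
    · rw [Set.indicator_of_notMem hx, gradient_of_notMem_tsupport hx, norm_zero]

theorem LipschitzWith.integrable_norm_gradient_sq {f : E → ℝ} {K : ℝ≥0} (hf : LipschitzWith K f)
    (hfc : HasCompactSupport f) : Integrable (fun x => ‖gradient f x‖ ^ 2) μ := by
  refine Integrable.mono' (((hf.integrable_gradient (μ := μ) hfc).norm).const_mul (K : ℝ))
    ((measurable_gradient f).norm.pow_const 2).aestronglyMeasurable
    (Eventually.of_forall fun x => ?_)
  rw [Real.norm_of_nonneg (by positivity), sq]
  exact mul_le_mul_of_nonneg_right (hf.norm_gradient_le x) (norm_nonneg _)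

/-- Energy inequality for a bounded Lipschitz `w ≥ 0` satisfying `Δw + C₀ w^q ≥ 0` weakly against
Lipschitz test functions supported in the support of `φ`. -/
theorem integral_sq_mul_rpow_ge_of_weak {q C₀ s M : ℝ} (hq : 1 < q) (hC₀ : 0 < C₀) (hs : 1 < s)
    {w φ : E → ℝ} {K L : ℝ≥0} (hw : LipschitzWith L w) (hwM : ∀ x, w x ∈ Set.Icc 0 M)
    (hφ : LipschitzWith K φ) (hφc : HasCompactSupport φ) (hφ0 : ∀ x, 0 ≤ φ x)
    (hweak : ∀ ψ : E → ℝ, (∃ C, LipschitzWith C ψ) → tsupport ψ ⊆ tsupport φ → (∀ x, 0 ≤ ψ x) →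
      0 ≤ ∫ x, (-⟪gradient w x, gradient ψ x⟫ + C₀ * w x ^ q * ψ x) ∂μ) :
    ∫ x, φ x ^ 2 * w x ^ (q + s - 1) ∂μ ≥
      C₀⁻¹ * ∫ x, ((2 * (s - 1) / s ^ 2) * (φ x ^ 2 * ‖gradient (fun y => w y ^ (s / 2)) x‖ ^ 2)
        - (2 / (s - 1)) * ‖gradient φ x‖ ^ 2 * w x ^ s) ∂μ := by
  have hw0 : ∀ x, 0 ≤ w x := fun x => (hwM x).1
  have hM : 0 ≤ M := (hw0 0).trans (hwM 0).2
  have hs1 : 0 < s - 1 := sub_pos.2 hs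
  have hwm : Measurable w := hw.continuous.measurable
  have hφm : Measurable φ := hφ.continuous.measurable
  have hgw : Measurable fun x => ‖gradient w x‖ := (measurable_gradient w).norm
  have hgφ : Measurable fun x => ‖gradient φ x‖ := (measurable_gradient φ).norm
  obtain ⟨N, hN⟩ := hφ.continuous.bounded_above_of_compact_support hφc
  have hφN : ∀ x, φ x ∈ Set.Icc 0 N := fun x => ⟨hφ0 x, (le_abs_self _).trans (hN x)⟩
  have hφ2 : Integrable (fun x => φ x ^ 2) μ := by
    refine (hφ.continuous.pow 2).integrable_of_hasCompactSupport (hφc.mono fun x hx => ?_)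
    contrapose! hx
    simp [Function.notMem_support.1 hx]
  have hgφ2 : Integrable (fun x => ‖gradient φ x‖ ^ 2) μ := hφ.integrable_norm_gradient_sq hφc
  have hws : Integrable (fun x => 2 / (s - 1) * ‖gradient φ x‖ ^ 2 * w x ^ s) μ := by
    refine Integrable.mono' ((hgφ2.const_mul (2 / (s - 1))).mul_const (M ^ s))
      (by fun_prop) (Eventually.of_forall fun x => ?_)
    have := Real.rpow_nonneg (hw0 x) s
    rw [Real.norm_of_nonneg (by positivity)]
    exact mul_le_mul_of_nonneg_left (Real.rpow_le_rpow (hw0 x) (hwM x).2 (by linarith))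
      (by positivity)
  have hwqs : Integrable (fun x => φ x ^ 2 * w x ^ (q + s - 1)) μ := by
    refine Integrable.mono' (hφ2.mul_const (M ^ (q + s - 1)))
      (by fun_prop) (Eventually.of_forall fun x => ?_)
    have := Real.rpow_nonneg (hw0 x) (q + s - 1)
    rw [Real.norm_of_nonneg (by positivity)]
    exact mul_le_mul_of_nonneg_left (Real.rpow_le_rpow (hw0 x) (hwM x).2 (by linarith))
      (by positivity)
  have hLHS : 0 ≤ ∫ x, φ x ^ 2 * w x ^ (q + s - 1) ∂μ := integral_nonneg fun x =>
    mul_nonneg (sq_nonneg _) (Real.rpow_nonneg (hw0 x) _)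
  set P : E → ℝ := fun x => φ x ^ 2 * ‖gradient (fun y => w y ^ (s / 2)) x‖ ^ 2 with hP
  set D : E → ℝ := fun x => (2 * (s - 1) / s ^ 2) * P x
    - (2 / (s - 1)) * ‖gradient φ x‖ ^ 2 * w x ^ s with hD
  by_cases hDi : Integrable D μ
  swap
  · rw [integral_undef hDi, mul_zero]
    exact hLHS
  have hPi : Integrable P μ := by
    have h1 : P = fun x => s ^ 2 / (2 * (s - 1)) * (D x
        + (2 / (s - 1)) * ‖gradient φ x‖ ^ 2 * w x ^ s) := by
      ext x
      simp only [hD]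
      field_simp
      ring
    rw [h1]
    exact (hDi.add hws).const_mul _
  have hae : ∀ᵐ x ∂μ, DifferentiableAt ℝ w x ∧ DifferentiableAt ℝ φ x :=
    hw.ae_differentiableAt.and hφ.ae_differentiableAt
  let ε : ℕ → ℝ := fun k => 1 / (k + 1)
  have hε0 : ∀ k, 0 < ε k := fun k => Nat.one_div_pos_of_nat
  have hε1 : ∀ k, ε k ≤ 1 := fun k => by
    have : (0 : ℝ) ≤ k := k.cast_nonneg
    exact (div_le_one (by positivity)).2 (by linarith)
  have hεt : Tendsto ε atTop (𝓝 0) := tendsto_one_div_add_atTop_nhds_zero_nat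
  let R : ℕ → E → ℝ := fun k x =>
    -((s - 1) / 2 * (φ x ^ 2 *
      if 0 < w x then (w x + ε k) ^ (s - 2) * ‖gradient w x‖ ^ 2 else 0))
    + 2 / (s - 1) * (‖gradient φ x‖ ^ 2 * (w x + ε k) ^ s)
    + C₀ * (φ x ^ 2 * (w x ^ q * (w x + ε k) ^ (s - 1)))
  have hRm : ∀ k, AEStronglyMeasurable (R k) μ := fun k => by
    refine Measurable.aestronglyMeasurable ?_
    have h1 : Measurable fun x =>
        if 0 < w x then (w x + ε k) ^ (s - 2) * ‖gradient w x‖ ^ 2 else 0 :=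
      Measurable.ite (measurableSet_lt measurable_const hwm) (by fun_prop) measurable_const
    fun_prop
  let b : E → ℝ := fun x =>
    (s - 1) / 2 * (4 / s ^ 2 * P x + φ x ^ 2 * ((M + 1) ^ (s - 2) * (L : ℝ) ^ 2))
    + 2 / (s - 1) * (‖gradient φ x‖ ^ 2 * (M + 1) ^ s)
    + C₀ * (φ x ^ 2 * (M ^ q * (M + 1) ^ (s - 1)))
  have hb : Integrable b μ :=
    ((((hPi.const_mul _).add (hφ2.mul_const _)).const_mul _).add
      ((hgφ2.mul_const _).const_mul _)).add ((hφ2.mul_const _).const_mul _)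
  have hRb : ∀ k, ∀ᵐ x ∂μ, ‖R k x‖ ≤ b x := fun k => by
    filter_upwards [hae] with x hx
    have hwε : 0 < w x + ε k := add_pos_of_nonneg_of_pos (hw0 x) (hε0 k)
    have hwε1 : w x + ε k ≤ M + 1 := add_le_add (hwM x).2 (hε1 k)
    refine (norm_add₃_le).trans (add_le_add (add_le_add ?_ ?_) ?_)
    · rw [norm_neg, norm_mul, Real.norm_of_nonneg (by positivity : 0 ≤ (s - 1) / 2)]
      refine mul_le_mul_of_nonneg_left ?_ (by positivity)
      simp only [hP]
      rw [norm_gradient_rpow_sq hw0 (by linarith) hx.1]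
      have hM1 : 0 ≤ (M + 1) ^ (s - 2) := Real.rpow_nonneg (by linarith) _
      split_ifs with h
      · have h1 := Real.rpow_le_rpow_add_rpow (s - 2) h
          (le_add_of_nonneg_right (hε0 k).le) hwε1
        have h2 : ‖gradient w x‖ ^ 2 ≤ (L : ℝ) ^ 2 :=
          pow_le_pow_left₀ (norm_nonneg _) (hw.norm_gradient_le x) 2
        have h3 : 0 ≤ (w x + ε k) ^ (s - 2) := Real.rpow_nonneg hwε.le _
        rw [Real.norm_of_nonneg (by positivity)]
        calc φ x ^ 2 * ((w x + ε k) ^ (s - 2) * ‖gradient w x‖ ^ 2)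
            ≤ φ x ^ 2 * ((w x ^ (s - 2) + (M + 1) ^ (s - 2)) * ‖gradient w x‖ ^ 2) := by gcongr
          _ = φ x ^ 2 * (w x ^ (s - 2) * ‖gradient w x‖ ^ 2)
              + φ x ^ 2 * ((M + 1) ^ (s - 2) * ‖gradient w x‖ ^ 2) := by ring
          _ ≤ φ x ^ 2 * (w x ^ (s - 2) * ‖gradient w x‖ ^ 2)
              + φ x ^ 2 * ((M + 1) ^ (s - 2) * (L : ℝ) ^ 2) := by gcongr
          _ = _ := by
            have : s ≠ 0 := by linarith
            field_simp
      · simp only [mul_zero, norm_zero, zero_add]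
        positivity
    · have h3 : 0 ≤ (w x + ε k) ^ s := Real.rpow_nonneg hwε.le _
      rw [Real.norm_of_nonneg (by positivity)]
      gcongr
    · have h3 : 0 ≤ (w x + ε k) ^ (s - 1) := Real.rpow_nonneg hwε.le _
      have h4 : 0 ≤ w x ^ q := Real.rpow_nonneg (hw0 x) _
      have h5 : 0 ≤ M ^ q := Real.rpow_nonneg hM _
      have h6 : w x ^ q ≤ M ^ q := Real.rpow_le_rpow (hw0 x) (hwM x).2 (by linarith)
      rw [Real.norm_of_nonneg (by positivity)]
      gcongr
  have hR0 : ∀ k, 0 ≤ ∫ x, R k x ∂μ := fun k => by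
    set ψ : E → ℝ := fun x => φ x ^ 2 * (w x + ε k) ^ (s - 1) with hψ
    have hψl : ∃ C, LipschitzWith C ψ :=
      hφ.exists_lipschitzWith_sq_mul_add_rpow hw (hε0 k) hφN hwM
    have hψφ : tsupport ψ ⊆ tsupport φ := closure_mono fun x hx => by
      contrapose! hx
      simp [hψ, Function.notMem_support.1 hx]
    have hψ0 : ∀ x, 0 ≤ ψ x := fun x =>
      mul_nonneg (sq_nonneg _) (Real.rpow_nonneg (add_nonneg (hw0 x) (hε0 k).le) _)
    have hψc : HasCompactSupport ψ := hφc.of_isClosed_subset (isClosed_tsupport _) hψφ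
    refine (hweak ψ hψl hψφ hψ0).trans (integral_mono_ae ?_ (hb.mono' (hRm k) (hRb k)) ?_)
    · obtain ⟨C, hC⟩ := hψl
      have h1 : Integrable (fun x => ⟪gradient w x, gradient ψ x⟫) μ := by
        refine Integrable.mono' ((hC.integrable_gradient (μ := μ) hψc).norm.const_mul (L : ℝ))
          ((measurable_gradient w).inner (measurable_gradient ψ)).aestronglyMeasurable
          (Eventually.of_forall fun x => ?_)
        exact (norm_inner_le_norm _ _).trans
          (mul_le_mul_of_nonneg_right (hw.norm_gradient_le x) (norm_nonneg _))
      have h2 : Integrable (fun x => C₀ * w x ^ q * ψ x) μ := by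
        refine Continuous.integrable_of_hasCompactSupport ?_ hψc.mul_left
        exact (continuous_const.mul (hw.continuous.rpow_const fun x => Or.inr (by linarith))).mul
          hC.continuous
      exact h1.neg.add h2
    · filter_upwards [hae] with x hx
      have hwε : 0 < w x + ε k := add_pos_of_nonneg_of_pos (hw0 x) (hε0 k)
      have h1 := neg_inner_le_of_young (gradient w x) (gradient φ x) hwε hs (hφ0 x)
      rw [← (hasGradientAt_sq_mul_add_rpow (p := s - 1) hx.2 hx.1 hwε).gradient] at h1
      have h2 : (φ x ^ 2 * if 0 < w x then (w x + ε k) ^ (s - 2) * ‖gradient w x‖ ^ 2 else 0)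
          ≤ φ x ^ 2 * ((w x + ε k) ^ (s - 2) * ‖gradient w x‖ ^ 2) := by
        refine mul_le_mul_of_nonneg_left ?_ (sq_nonneg _)
        split_ifs
        · exact le_rfl
        · have := Real.rpow_nonneg hwε.le (s - 2)
          positivity
      have h3 := mul_le_mul_of_nonneg_left h2 (half_pos hs1).le
      have h4 : C₀ * w x ^ q * ψ x =
          C₀ * (φ x ^ 2 * (w x ^ q * (w x + ε k) ^ (s - 1))) := by
        simp only [hψ]
        ring
      simp only [R]
      linarith
  have hlim : Tendsto (fun k => ∫ x, R k x ∂μ) atTop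
      (𝓝 (∫ x, (C₀ * (φ x ^ 2 * w x ^ (q + s - 1)) - D x) ∂μ)) := by
    refine tendsto_integral_of_dominated_convergence b hRm hb hRb ?_
    filter_upwards [hae] with x hx
    have hwt : Tendsto (fun k => w x + ε k) atTop (𝓝 (w x)) := by
      simpa using hεt.const_add (w x)
    have hqs : w x ^ (q + s - 1) = w x ^ q * w x ^ (s - 1) := by
      rw [← Real.rpow_add_of_nonneg (hw0 x) (by linarith) hs1.le]
      ring_nf
    have hgoal : C₀ * (φ x ^ 2 * w x ^ (q + s - 1)) - D x =
        -((s - 1) / 2 * (φ x ^ 2 *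
          if 0 < w x then w x ^ (s - 2) * ‖gradient w x‖ ^ 2 else 0))
        + 2 / (s - 1) * (‖gradient φ x‖ ^ 2 * w x ^ s)
        + C₀ * (φ x ^ 2 * (w x ^ q * w x ^ (s - 1))) := by
      simp only [hD, hP]
      rw [norm_gradient_rpow_sq hw0 (by linarith) hx.1, hqs]
      have : s ≠ 0 := by linarith
      split_ifs
      · field_simp
        ring
      · ring
    rw [hgoal]
    refine ((Tendsto.const_mul _ (Tendsto.const_mul _ ?_)).neg.add
      (Tendsto.const_mul _ (Tendsto.const_mul _ ?_))).add
      (Tendsto.const_mul _ (Tendsto.const_mul _ (Tendsto.const_mul _ ?_)))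
    · split_ifs with h
      · exact (hwt.rpow_const (Or.inl h.ne')).mul_const _
      · exact tendsto_const_nhds
    · exact hwt.rpow_const (Or.inr (by linarith))
    · exact hwt.rpow_const (Or.inr hs1.le)
  have hfin := ge_of_tendsto' hlim hR0
  rw [integral_sub (hwqs.const_mul _) hDi, integral_const_mul] at hfin
  rw [ge_iff_le, inv_mul_le_iff₀ hC₀]
  linarith

end Caccioppoli

theorem LocallyLipschitzOn.exists_lipschitzWith_eqOn_isCompact {X : Type*} [PseudoMetricSpace X]
    {S : Set X} {u : X → ℝ} (hS : IsCompact S) (hu : LocallyLipschitzOn S u)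
    (hu0 : ∀ x ∈ S, 0 ≤ u x) :
    ∃ (L : ℝ≥0) (M : ℝ) (w : X → ℝ), LipschitzWith L w ∧ (∀ x, w x ∈ Set.Icc 0 M) ∧
      Set.EqOn w u S := by
  obtain ⟨L, hL⟩ := hu.exists_lipschitzOnWith_of_compact hS
  obtain ⟨g, hg, hgu⟩ := hL.extend_real
  obtain ⟨M, hM⟩ := hS.exists_bound_of_continuousOn hL.continuousOn
  refine ⟨L, max M 0, fun x => max (min (g x) (max M 0)) 0,
    (hg.min_const _).max_const _, fun x => ⟨le_max_right _ _, ?_⟩, fun x hx => ?_⟩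
  · exact max_le (min_le_right _ _) (le_max_right _ _)
  · have h1 : u x ≤ max M 0 := (le_abs_self _).trans ((hM x hx).trans (le_max_left _ _))
    simp only [← hgu hx, min_eq_left h1, max_eq_left (hu0 x hx)]

/-- **Basic test-function inequality.** For a nonnegative locally Lipschitz weak
supersolution `u` of `Δu + C₀ u^q ≥ 0` on an open `Ω`, every `s > 1` and nonnegative
compactly supported Lipschitz `φ` in `Ω`:
`∫ φ² u^{q+s-1} ≥ C₀⁻¹ ∫ ((2(s-1)/s²) |φ ∇(u^{s/2})|² − (2/(s-1)) |∇φ|² uˢ)`. -/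
theorem test_function_inequality
    (n : ℕ) (hn : 3 ≤ n) (q C0 s : ℝ) (hq : 1 < q) (hC0 : 0 < C0) (hs : 1 < s)
    (Ω : Set (EuclideanSpace ℝ (Fin n))) (hΩ : IsOpen Ω)
    (u : EuclideanSpace ℝ (Fin n) → ℝ)
    (hu0 : ∀ x ∈ Ω, 0 ≤ u x)
    (hulip : LocallyLipschitzOn Ω u)
    (hsup : IsWeakSupersol Ω u (fun x => C0 * u x ^ q))
    (φ : EuclideanSpace ℝ (Fin n) → ℝ) (hφlip : ∃ K, LipschitzWith K φ)
    (hφc : HasCompactSupport φ) (hφΩ : tsupport φ ⊆ Ω) (hφ0 : ∀ x, 0 ≤ φ x) :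
    ∫ x in Ω, φ x ^ 2 * u x ^ (q + s - 1)
      ≥ C0⁻¹ * ∫ x in Ω,
          ((2 * (s - 1) / s ^ 2) * (φ x ^ 2 * ‖gradient (fun y => u y ^ (s / 2)) x‖ ^ 2)
            - (2 / (s - 1)) * ‖gradient φ x‖ ^ 2 * u x ^ s) := by
  obtain ⟨Kφ, hφlip⟩ := hφlip
  obtain ⟨δ, hδ, hδΩ⟩ := IsCompact.exists_cthickening_subset_open hφc hΩ hφΩ
  have hS : IsCompact (cthickening δ (tsupport φ)) := IsCompact.cthickening hφc
  obtain ⟨L, M, w, hw, hwM, hwu⟩ := LocallyLipschitzOn.exists_lipschitzWith_eqOn_isCompact hS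
    (hulip.mono hδΩ) fun x hx => hu0 x (hδΩ hx)
  have hUΩ : thickening δ (tsupport φ) ⊆ Ω := (thickening_subset_cthickening _ _).trans hδΩ
  have hwu' : ∀ x ∈ thickening δ (tsupport φ), w =ᶠ[𝓝 x] u := fun x hx =>
    eventually_of_mem (isOpen_thickening.mem_nhds hx) fun y hy =>
      hwu (thickening_subset_cthickening _ _ hy)
  have hφU : tsupport φ ⊆ thickening δ (tsupport φ) := self_subset_thickening hδ _
  have hweak : ∀ ψ : EuclideanSpace ℝ (Fin n) → ℝ, (∃ C, LipschitzWith C ψ) →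
      tsupport ψ ⊆ tsupport φ → (∀ x, 0 ≤ ψ x) →
      0 ≤ ∫ x, (-⟪gradient w x, gradient ψ x⟫ + C0 * w x ^ q * ψ x) := by
    have hconv : ∀ ψ : EuclideanSpace ℝ (Fin n) → ℝ, ∀ x,
        fderiv ℝ ψ x (-gradient w x) = -⟪gradient w x, gradient ψ x⟫ := fun ψ x => by
      rw [real_inner_comm, gradient, gradient, InnerProductSpace.toDual_symm_apply, map_neg]
    rintro ψ ⟨C, hC⟩ hψφ hψ0
    simp only [← hconv]
    refine hC.integral_fderiv_add_nonneg_of_smooth (U := thickening δ (tsupport φ)) (A := L)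
      (B := C0 * M ^ q) isOpen_thickening (measurable_gradient w).neg ?_ ?_ ?_ ?_
      (hφc.of_isClosed_subset (isClosed_tsupport _) hψφ) (hψφ.trans hφU) hψ0
    · have := hw.continuous.measurable
      fun_prop
    · exact fun x => (norm_neg _).trans_le (hw.norm_gradient_le x)
    · intro x
      have := Real.rpow_nonneg (hwM x).1 q
      rw [abs_of_nonneg (by positivity)]
      exact mul_le_mul_of_nonneg_left
        (Real.rpow_le_rpow (hwM x).1 (hwM x).2 (by linarith)) hC0.le
    · intro η hη hηc hηU hη0
      have h := hsup η hη hηc (hΩ.interior_eq.symm ▸ hηU.trans hUΩ) hη0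
      rw [setIntegral_eq_integral_of_forall_compl_eq_zero] at h
      · refine h.trans_eq (integral_congr_ae (Eventually.of_forall fun x => ?_))
        simp only [Pi.neg_apply, hconv]
        by_cases hx : x ∈ tsupport η
        · rw [(hwu' x (hηU hx)).gradient_eq, (hwu' x (hηU hx)).eq_of_nhds]
        · simp [gradient_of_notMem_tsupport hx, image_eq_zero_of_notMem_tsupport hx]
      · intro x hx
        have hx' : x ∉ tsupport η := fun h' => hx (hUΩ (hηU h'))
        simp [gradient_of_notMem_tsupport hx', image_eq_zero_of_notMem_tsupport hx']
  have h := integral_sq_mul_rpow_ge_of_weak (μ := volume) hq hC0 hs hw hwM hφlip hφc hφ0 hweak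
  rw [setIntegral_eq_integral_of_forall_compl_eq_zero,
    setIntegral_eq_integral_of_forall_compl_eq_zero]
  · convert h using 3 with x
    · by_cases hx : x ∈ tsupport φ
      · rw [(hwu' x (hφU hx)).eq_of_nhds]
      · simp [image_eq_zero_of_notMem_tsupport hx]
    · ext x
      by_cases hx : x ∈ tsupport φ
      · have hx' := hwu' x (hφU hx)
        have hx'' : (fun y => w y ^ (s / 2)) =ᶠ[𝓝 x] fun y => u y ^ (s / 2) :=
          hx'.fun_comp (· ^ (s / 2))
        rw [hx''.gradient_eq, hx'.eq_of_nhds]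
      · simp [gradient_of_notMem_tsupport hx, image_eq_zero_of_notMem_tsupport hx]
  all_goals
    intro x hx
    have hx' : x ∉ tsupport φ := fun h' => hx (hφΩ h')
    simp [gradient_of_notMem_tsupport hx', image_eq_zero_of_notMem_tsupport hx']
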